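/- arXiv:2503.07467 — 6 statements merged into one kernel-verified Lean document; each statement's English description precedes it below -/
import Mathlib

section
/- Let n, N be positive integers, A = (a_{ij}) a symmetric real n×n matrix, and ρ* ∈ ℝⁿ with Λ(ρ*) = 0, where Λ(ρ) = (2/(πN))·Σ_i ρ_i − (1/(4π²N²))·Σ_{i,j} a_{ij} ρ_i ρ_j. Set m_i* = (1/(2πN))·Σ_j a_{ij} ρ_j* and assume m_i* > 2 for every i. Then there exist constants δ > 0 and c > 0 such that for every s ∈ ℝⁿ satisfying s_i·s_j ≥ 0 for all i, j (all components of s have the same sign) and max_i |s_i| ≤ δ, one has |Λ(ρ* + s)| ≥ c · max_i |s_i|. -/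
open Finset

/-- The function `Λ_{I,N}` of the paper (equation (1.3)). -/
noncomputable def LambdaIN (n N : ℕ) (A : Matrix (Fin n) (Fin n) ℝ) (ρ : Fin n → ℝ) : ℝ :=
  (2 / (Real.pi * N)) * ∑ i, ρ i
    - (1 / (4 * Real.pi ^ 2 * N ^ 2)) * ∑ i, ∑ j, A i j * ρ i * ρ j


lemma lam_expand (n N : ℕ) (hN : 0 < N)
    (A : Matrix (Fin n) (Fin n) ℝ) (hA : A.IsSymm) (r s : Fin n → ℝ) :
    LambdaIN n N A (r + s) = LambdaIN n N A r
      - (1 / (Real.pi * N)) * ∑ i, s i * ((1 / (2 * Real.pi * N)) * ∑ j, A i j * r j - 2)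
      - (1 / (4 * Real.pi ^ 2 * N ^ 2)) * ∑ i, ∑ j, A i j * s i * s j := by
  have h1 : ∑ i, ∑ j, A i j * r i * s j = ∑ i, s i * ∑ j, A i j * r j := by
    rw [Finset.sum_comm]
    refine Finset.sum_congr rfl fun i _ => ?_
    rw [Finset.mul_sum]
    refine Finset.sum_congr rfl fun j _ => ?_
    rw [hA.apply i j]
    ring
  have h2 : ∑ i, ∑ j, A i j * s i * r j = ∑ i, s i * ∑ j, A i j * r j := by
    refine Finset.sum_congr rfl fun i _ => ?_
    rw [Finset.mul_sum]
    refine Finset.sum_congr rfl fun j _ => ?_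
    ring
  have h3 : ∑ i, ∑ j, A i j * (r + s) i * (r + s) j
      = ∑ i, ∑ j, A i j * r i * r j + 2 * ∑ i, s i * ∑ j, A i j * r j
        + ∑ i, ∑ j, A i j * s i * s j := by
    rw [two_mul]
    nth_rewrite 1 [← h1]
    rw [← h2]
    simp only [← Finset.sum_add_distrib]
    refine Finset.sum_congr rfl fun i _ => Finset.sum_congr rfl fun j _ => ?_
    simp only [Pi.add_apply]
    ring
  have h4 : ∑ i, s i * ((1 / (2 * Real.pi * N)) * ∑ j, A i j * r j - 2)
      = (1 / (2 * Real.pi * N)) * (∑ i, s i * ∑ j, A i j * r j) - 2 * ∑ i, s i := by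
    rw [Finset.mul_sum, Finset.mul_sum, ← Finset.sum_sub_distrib]
    refine Finset.sum_congr rfl fun i _ => ?_
    ring
  have hN' : (N : ℝ) ≠ 0 := by positivity
  have hp := Real.pi_ne_zero
  unfold LambdaIN
  rw [h3, h4]
  simp only [Pi.add_apply, Finset.sum_add_distrib]
  field_simp
  ring

lemma same_sign_sum (n : ℕ) (s w : Fin n → ℝ) (g : ℝ) (hs : ∀ i j, 0 ≤ s i * s j)
    (hg : 0 < g) (hw : ∀ i, g ≤ w i) : g * ∑ i, |s i| ≤ |∑ i, s i * w i| := by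
  rw [Finset.mul_sum]
  by_cases h : ∃ i, 0 < s i
  · obtain ⟨i0, h0⟩ := h
    have h' : ∀ i, 0 ≤ s i := fun i => nonneg_of_mul_nonneg_right (hs i0 i) h0
    refine le_trans (Finset.sum_le_sum fun i _ => ?_) (le_abs_self _)
    rw [abs_of_nonneg (h' i)]
    nlinarith [h' i, hw i]
  · push Not at h
    refine le_trans ?_ (neg_le_abs _)
    rw [← Finset.sum_neg_distrib]
    refine Finset.sum_le_sum fun i _ => ?_
    rw [abs_of_nonpos (h i)]
    nlinarith [h i, hw i]

lemma quad_bound (n : ℕ) (A : Matrix (Fin n) (Fin n) ℝ) (s : Fin n → ℝ) (d : ℝ)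
    (hs : ∀ i, |s i| ≤ d) :
    |∑ i, ∑ j, A i j * s i * s j| ≤ (∑ i, ∑ j, |A i j|) * (d * ∑ i, |s i|) := by
  rw [Finset.sum_mul]
  refine (Finset.abs_sum_le_sum_abs _ _).trans (Finset.sum_le_sum fun i _ => ?_)
  rw [Finset.sum_mul]
  refine (Finset.abs_sum_le_sum_abs _ _).trans (Finset.sum_le_sum fun j _ => ?_)
  rw [abs_mul, abs_mul, mul_assoc]
  have h1 : |s j| ≤ ∑ i, |s i| :=
    Finset.single_le_sum (f := fun i => |s i|) (fun i _ => abs_nonneg _) (Finset.mem_univ j)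
  have h2 := hs i
  have h3 : 0 ≤ d := (abs_nonneg _).trans h2
  gcongr

/-- near a point `ρ*` of the hypersurface `Λ_{I,N} = 0` with all `m_i* > 2`,
`|Λ_{I,N}|` controls the size of a same-sign perturbation. -/
theorem lambda_coercive (n N : ℕ) (hn : 0 < n) (hN : 0 < N)
    (A : Matrix (Fin n) (Fin n) ℝ) (hA : A.IsSymm)
    (ρstar : Fin n → ℝ)
    (hΛ : LambdaIN n N A ρstar = 0)
    (hm : ∀ i, 2 < (1 / (2 * Real.pi * N)) * ∑ j, A i j * ρstar j) :
    ∃ δ > (0:ℝ), ∃ c > (0:ℝ), ∀ s : Fin n → ℝ,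
      (∀ i j, 0 ≤ s i * s j) →
      (∀ i, |s i| ≤ δ) →
      ∀ i, c * |s i| ≤ |LambdaIN n N A (ρstar + s)| := by
  haveI : Nonempty (Fin n) := ⟨⟨0, hn⟩⟩
  obtain ⟨i0, hi0⟩ := Finite.exists_min
    (fun i => (1 / (2 * Real.pi * N)) * ∑ j, A i j * ρstar j - 2)
  have hg0 := hm i0
  set w : Fin n → ℝ := fun i => (1 / (2 * Real.pi * N)) * ∑ j, A i j * ρstar j - 2 with hw
  have hg : 0 < w i0 := by simp only [hw]; linarith
  have hNr : (0 : ℝ) < N := by exact_mod_cast hN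
  have hp := Real.pi_pos
  have hk : 0 < 1 / (Real.pi * N) := by positivity
  have hK : 0 < 1 / (4 * Real.pi ^ 2 * N ^ 2) := by positivity
  have hM : 0 ≤ ∑ i, ∑ j, |A i j| :=
    Finset.sum_nonneg fun i _ => Finset.sum_nonneg fun j _ => abs_nonneg _
  have hex := lam_expand n N hN A hA ρstar
  rw [hΛ] at hex
  generalize 1 / (Real.pi * N) = k at *
  generalize 1 / (4 * Real.pi ^ 2 * N ^ 2) = K at *
  generalize hMd : ∑ i, ∑ j, |A i j| = M at *
  have hKM : 0 ≤ K * M := by positivity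
  refine ⟨k * w i0 / (2 * (K * M + 1)), by positivity, k * w i0 / 2, by positivity, ?_⟩
  intro s hs hd i
  have hq := quad_bound n A s _ hd
  have hl := same_sign_sum n s w (w i0) hs hg hi0
  have h1 : |s i| ≤ ∑ i, |s i| :=
    Finset.single_le_sum (f := fun i => |s i|) (fun i _ => abs_nonneg _) (Finset.mem_univ i)
  have hS : 0 ≤ ∑ i, |s i| := (abs_nonneg _).trans h1
  rw [hMd] at hq
  rw [hex s]
  change _ ≤ |0 - k * ∑ i, s i * w i - K * ∑ i, ∑ j, A i j * s i * s j|
  generalize ∑ i, ∑ j, A i j * s i * s j = Q at *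
  generalize ∑ i, s i * w i = L at *
  generalize ∑ i, |s i| = S at *
  have h2 : k * |L| - K * |Q| ≤ |0 - k * L - K * Q| := by
    have := abs_sub_abs_le_abs_sub (-(k * L)) (K * Q)
    rw [abs_neg, abs_mul, abs_mul, abs_of_pos hk, abs_of_pos hK] at this
    simpa using this
  have h3 : K * M * (k * w i0 / (2 * (K * M + 1))) ≤ k * w i0 / 2 := by
    rw [mul_div_assoc', div_le_div_iff₀ (by positivity) (by positivity)]
    nlinarith [mul_pos hk hg]
  have h4 : K * |Q| ≤ k * w i0 / 2 * S := by
    calc K * |Q| ≤ K * (M * (k * w i0 / (2 * (K * M + 1)) * S)) := by gcongr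
      _ = K * M * (k * w i0 / (2 * (K * M + 1))) * S := by ring
      _ ≤ _ := by gcongr
  have h5 : k * (w i0 * S) ≤ k * |L| := by gcongr
  have h6 : k * w i0 / 2 * |s i| ≤ k * w i0 / 2 * S := by gcongr
  linarith
end

section
/- Let n, N be positive integers, A = (a_{ij}) a symmetric real n×n matrix, and ρ* ∈ ℝⁿ with Λ(ρ*) = 0, where Λ(ρ) = (2/(πN))·Σ_i ρ_i − (1/(4π²N²))·Σ_{i,j} a_{ij} ρ_i ρ_j. Set m_i* = (1/(2πN))·Σ_j a_{ij} ρ_j*, assume m_i* > 2 for every i, and let m̂ = min_i m_i* satisfy 2 < m̂ ≤ 4. For every Λ₀ > 0 there exist Λ₀' > 0 and ε₀ ∈ (0,1) such that for all ε ∈ (0, ε₀) and all ρ ∈ ℝⁿ with (ρ_i − ρ_i*)·(ρ_j − ρ_j*) ≥ 0 for all i, j and max_i |ρ_i − ρ_i*| ≤ ε₀: if m̂ < 4 and |Λ(ρ)| ≤ Λ₀·ε^{m̂−2}, then max_i |ρ_i − ρ_i*| ≤ Λ₀'·ε^{m̂−2}; and if m̂ = 4 and |Λ(ρ)| ≤ Λ₀·ε²·log(1/ε),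 then max_i |ρ_i − ρ_i*| ≤ Λ₀'·ε²·log(1/ε). -/
open Finset

theorem same_sign_aux {n : ℕ} (d : Fin n → ℝ) (h : ∀ i j, 0 ≤ d i * d j) :
    (∀ i, d i = |d i|) ∨ (∀ i, d i = -|d i|) := by
  by_cases hp : ∃ i, 0 < d i
  · obtain ⟨i, hi⟩ := hp
    left
    intro j
    have := nonneg_of_mul_nonneg_right (h i j) hi
    rw [abs_of_nonneg this]
  · right
    intro j
    have : d j ≤ 0 := not_lt.mp fun hj => hp ⟨j, hj⟩
    rw [abs_of_nonpos this, neg_neg]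

theorem lower_aux {n : ℕ} (d w : Fin n → ℝ) (k : ℝ) (hw : ∀ i, k ≤ w i) (hk : 0 ≤ k)
    (h : ∀ i j, 0 ≤ d i * d j) :
    k * ∑ i, |d i| ≤ |∑ i, d i * w i| := by
  have h1 : k * ∑ i, |d i| ≤ ∑ i, |d i| * w i := by
    rw [Finset.mul_sum]
    refine Finset.sum_le_sum fun i _ => ?_
    rw [mul_comm]
    exact mul_le_mul_of_nonneg_left (hw i) (abs_nonneg _)
  rcases same_sign_aux d h with hs | hs
  · have : ∑ i, d i * w i = ∑ i, |d i| * w i :=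
      Finset.sum_congr rfl fun i _ => by rw [← hs i]
    rw [this]
    exact h1.trans (le_abs_self _)
  · have : ∑ i, d i * w i = -∑ i, |d i| * w i := by
      rw [← Finset.sum_neg_distrib]
      exact Finset.sum_congr rfl fun i _ => by
        have := hs i
        rw [← neg_mul, ← this]
    rw [this, abs_neg]
    exact h1.trans (le_abs_self _)

theorem quad_aux {n : ℕ} (A : Matrix (Fin n) (Fin n) ℝ) (d : Fin n → ℝ) (e : ℝ)
    (he : ∀ i, |d i| ≤ e) :
    |∑ i, ∑ j, A i j * d i * d j| ≤ (∑ i, ∑ j, |A i j|) * e * ∑ i, |d i| := by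
  have hS : ∀ j, |d j| ≤ ∑ i, |d i| := fun j =>
    Finset.single_le_sum (f := fun i => |d i|) (fun i _ => abs_nonneg _) (Finset.mem_univ j)
  calc |∑ i, ∑ j, A i j * d i * d j| ≤ ∑ i, ∑ j, |A i j * d i * d j| :=
        (Finset.abs_sum_le_sum_abs _ _).trans
          (Finset.sum_le_sum fun i _ => Finset.abs_sum_le_sum_abs _ _)
    _ ≤ ∑ i, ∑ j, |A i j| * e * ∑ i, |d i| := by
        refine Finset.sum_le_sum fun i _ => Finset.sum_le_sum fun j _ => ?_
        rw [abs_mul, abs_mul]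
        have h0 : 0 ≤ e := (abs_nonneg _).trans (he i)
        have h1 := he i
        have h2 := hS j
        gcongr
    _ = _ := by simp only [Finset.sum_mul]

theorem expand_aux (n N : ℕ) (hN : 0 < N)
    (A : Matrix (Fin n) (Fin n) ℝ) (hA : A.IsSymm) (r ρ m : Fin n → ℝ)
    (hmdef : ∀ i, m i = (1 / (2 * Real.pi * N)) * ∑ j, A i j * r j) :
    LambdaIN n N A ρ = LambdaIN n N A r
      - (1 / (Real.pi * N)) * ∑ i, (ρ i - r i) * (m i - 2)
      - (1 / (4 * Real.pi ^ 2 * N ^ 2)) *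
        ∑ i, ∑ j, A i j * (ρ i - r i) * (ρ j - r j) := by
  have hN' : (N : ℝ) ≠ 0 := by positivity
  have hpi := Real.pi_ne_zero
  have hm : ∀ i, ∑ j, A i j * r j = 2 * Real.pi * N * m i := by
    intro i; rw [hmdef]; field_simp
  have e1 : ∑ i, ∑ j, A i j * (ρ i - r i) * r j
      = 2 * Real.pi * N * ∑ i, (ρ i - r i) * m i := by
    rw [Finset.mul_sum]
    refine Finset.sum_congr rfl fun i _ => ?_
    calc _ = (ρ i - r i) * ∑ j, A i j * r j := by
          rw [Finset.mul_sum]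
          exact Finset.sum_congr rfl fun j _ => by ring
      _ = _ := by rw [hm]; ring
  have e2 : ∑ i, ∑ j, A i j * r i * (ρ j - r j)
      = ∑ i, ∑ j, A i j * (ρ i - r i) * r j := by
    rw [Finset.sum_comm]
    refine Finset.sum_congr rfl fun i _ => Finset.sum_congr rfl fun j _ => ?_
    rw [hA.apply i j]; ring
  have e3 : ∑ i, ∑ j, A i j * ρ i * ρ j = ∑ i, ∑ j, A i j * r i * r j
      + ∑ i, ∑ j, A i j * r i * (ρ j - r j) + ∑ i, ∑ j, A i j * (ρ i - r i) * r j
      + ∑ i, ∑ j, A i j * (ρ i - r i) * (ρ j - r j) := by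
    simp only [← Finset.sum_add_distrib]
    exact Finset.sum_congr rfl fun i _ => Finset.sum_congr rfl fun j _ => by ring
  have e4 : ∑ i, (ρ i - r i) * (m i - 2)
      = ∑ i, (ρ i - r i) * m i - 2 * (∑ i, ρ i - ∑ i, r i) := by
    rw [← Finset.sum_sub_distrib, Finset.mul_sum, ← Finset.sum_sub_distrib]
    exact Finset.sum_congr rfl fun i _ => by ring
  unfold LambdaIN
  rw [e3, e2, e1, e4]
  field_simp
  ring

/-- Lemma 2.2 of the paper.  If all the differences `ρ_i − ρ_i*` have the same
sign, an a priori bound `|Λ_{I,N}(ρ)| ≤ Λ₀ ε^{m̂−2}` (resp. `Λ₀ ε² log(1/ε)` when `m̂ = 4`)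
forces the same bound, with a larger constant, on each `|ρ_i − ρ_i*|`. -/
theorem lambda_rho_bound (n N : ℕ) (hn : 0 < n) (hN : 0 < N)
    (A : Matrix (Fin n) (Fin n) ℝ) (hA : A.IsSymm)
    (ρstar : Fin n → ℝ)
    (hΛ : LambdaIN n N A ρstar = 0)
    (m : Fin n → ℝ)
    (hmdef : ∀ i, m i = (1 / (2 * Real.pi * N)) * ∑ j, A i j * ρstar j)
    (hm2 : ∀ i, 2 < m i)
    (mhat : ℝ) (hmhat : IsLeast (Set.range m) mhat)
    (hmhat2 : 2 < mhat) (hmhat4 : mhat ≤ 4) :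
    ∀ Λ₀ > (0:ℝ), ∃ Λ₀' > (0:ℝ), ∃ ε₀ ∈ Set.Ioo (0:ℝ) 1,
      ∀ ε ∈ Set.Ioo (0:ℝ) ε₀, ∀ ρ : Fin n → ℝ,
        (∀ i j, 0 ≤ (ρ i - ρstar i) * (ρ j - ρstar j)) →
        (∀ i, |ρ i - ρstar i| ≤ ε₀) →
        ((mhat < 4 → |LambdaIN n N A ρ| ≤ Λ₀ * ε ^ (mhat - 2) →
            ∀ i, |ρ i - ρstar i| ≤ Λ₀' * ε ^ (mhat - 2)) ∧
         (mhat = 4 → |LambdaIN n N A ρ| ≤ Λ₀ * ε ^ 2 * Real.log (1 / ε) →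
            ∀ i, |ρ i - ρstar i| ≤ Λ₀' * ε ^ 2 * Real.log (1 / ε))) := by
  intro Λ₀ hΛ₀
  have hNp : (0:ℝ) < N := by exact_mod_cast hN
  have hpi := Real.pi_pos
  obtain ⟨c, hc⟩ : ∃ c, c = 1 / (4 * Real.pi ^ 2 * (N:ℝ) ^ 2) := ⟨_, rfl⟩
  obtain ⟨b, hb⟩ : ∃ b, b = 1 / (Real.pi * (N:ℝ)) := ⟨_, rfl⟩
  obtain ⟨M, hM⟩ : ∃ M, M = ∑ i, ∑ j, |A i j| := ⟨_, rfl⟩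
  have hcp : 0 < c := by rw [hc]; positivity
  have hbp : 0 < b := by rw [hb]; positivity
  have hMp : 0 ≤ M := by rw [hM]; positivity
  obtain ⟨k, hk⟩ : ∃ k, k = b * (mhat - 2) := ⟨_, rfl⟩
  have hkp : 0 < k := by rw [hk]; exact mul_pos hbp (by linarith)
  obtain ⟨e, he⟩ : ∃ e, e = min (1/2) (k / (2 * (c * M + 1))) := ⟨_, rfl⟩
  have hep : 0 < e := by rw [he]; exact lt_min (by norm_num) (by positivity)
  have he1 : e ≤ 1/2 := he ▸ min_le_left _ _
  have he2 : c * M * e ≤ k / 2 := by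
    have : e ≤ k / (2 * (c * M + 1)) := he ▸ min_le_right _ _
    rw [le_div_iff₀ (by positivity)] at this
    linarith
  have key : ∀ ρ : Fin n → ℝ, (∀ i j, 0 ≤ (ρ i - ρstar i) * (ρ j - ρstar j)) →
      (∀ i, |ρ i - ρstar i| ≤ e) → ∀ B, |LambdaIN n N A ρ| ≤ Λ₀ * B →
      ∀ i, |ρ i - ρstar i| ≤ 2 * Λ₀ / k * B := by
    intro ρ hs hle B hB i
    have hx := expand_aux n N hN A hA ρstar ρ m hmdef
    rw [hΛ, ← hc, ← hb] at hx
    have h1 := lower_aux (fun i => ρ i - ρstar i) (fun i => m i - 2) (mhat - 2)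
      (fun i => by have := hmhat.2 ⟨i, rfl⟩; linarith) (by linarith) hs
    have h2 := quad_aux A (fun i => ρ i - ρstar i) e hle
    rw [← hM] at h2
    have h3 := Finset.single_le_sum (f := fun i => |ρ i - ρstar i|)
      (fun i _ => abs_nonneg _) (Finset.mem_univ i)
    beta_reduce at h1 h2 h3
    generalize ∑ i, (ρ i - ρstar i) * (m i - 2) = P at *
    generalize ∑ i, ∑ j, A i j * (ρ i - ρstar i) * (ρ j - ρstar j) = Q at *
    generalize ∑ i, |ρ i - ρstar i| = S at *
    have hS : 0 ≤ S := (abs_nonneg _).trans h3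
    have h4 : b * |P| ≤ |LambdaIN n N A ρ| + c * |Q| := by
      rw [← abs_of_pos hbp, ← abs_of_pos hcp, ← abs_mul, ← abs_mul]
      have : b * P = -(LambdaIN n N A ρ + c * Q) := by rw [hx]; ring
      rw [this, abs_neg]
      exact abs_add_le _ _
    have h5 : k * S ≤ b * |P| := by
      rw [hk, mul_assoc]; exact mul_le_mul_of_nonneg_left h1 hbp.le
    have h6 : c * |Q| ≤ k / 2 * S := by
      calc c * |Q| ≤ c * (M * e * S) := mul_le_mul_of_nonneg_left h2 hcp.le
        _ = (c * M * e) * S := by ring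
        _ ≤ _ := mul_le_mul_of_nonneg_right he2 hS
    have h7 : k * S ≤ 2 * (Λ₀ * B) := by linarith
    have h8 : S ≤ 2 * Λ₀ / k * B := by
      rw [div_mul_eq_mul_div, le_div_iff₀ hkp]; linarith
    exact h3.trans h8
  refine ⟨2 * Λ₀ / k, by positivity, e, ⟨hep, by linarith⟩, ?_⟩
  intro ε _ ρ hs hle
  refine ⟨fun _ hB => key ρ hs hle _ hB, fun _ hB i => ?_⟩
  rw [mul_assoc] at hB ⊢
  exact key ρ hs hle _ hB i
end

section
/- Let N, n be positive integers, and let c, T, m : Fin n → ℝ satisfy c_i > 0, T_i > 0 and m_i > 2 for every i. Set S = Σ_i (m_i − 2)²·c_i and T̄ = Σ_i T_i. Define the real matrix M indexed by Fin N ⊕ Fin n by: M(t, t') = (N−1)·S + T̄ if t = t' (t, t' in the Fin N block), M(t, t') = (N−2)·S if t ≠ t'; M(t, i) = M(i, t) = (N−1)·(2 − m_i)·c_i for t in the Fin N block and i in the Fin n block; and M(i, i') = N·c_i if i = i', M(i, i') = 0 if i ≠ i' (i, i' in the Fin n block). Then M is invertible (its determinant is nonzero). -/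
open Finset

/-- invertibility of the block matrix `((G₁, G₃ᵀ), (G₃, G₂))` from
Lemma 3.1 / Theorem A.1 of the paper. -/
theorem block_matrix_invertible (N n : ℕ) (hN : 0 < N) (hn : 0 < n)
    (c T m : Fin n → ℝ)
    (hc : ∀ i, 0 < c i) (hT : ∀ i, 0 < T i) (hm : ∀ i, 2 < m i)
    (M : Matrix (Fin N ⊕ Fin n) (Fin N ⊕ Fin n) ℝ)
    (hMtt : ∀ t t' : Fin N, M (Sum.inl t) (Sum.inl t') =
      if t = t' then ((N : ℝ) - 1) * (∑ i, (m i - 2) ^ 2 * c i) + (∑ i, T i)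
      else ((N : ℝ) - 2) * (∑ i, (m i - 2) ^ 2 * c i))
    (hMti : ∀ (t : Fin N) (i : Fin n),
      M (Sum.inl t) (Sum.inr i) = ((N : ℝ) - 1) * (2 - m i) * c i)
    (hMit : ∀ (i : Fin n) (t : Fin N),
      M (Sum.inr i) (Sum.inl t) = ((N : ℝ) - 1) * (2 - m i) * c i)
    (hMii : ∀ i i' : Fin n, M (Sum.inr i) (Sum.inr i') =
      if i = i' then (N : ℝ) * c i else 0) :
    M.det ≠ 0 := by
  intro hdet
  obtain ⟨v, hv0, hv⟩ := Matrix.exists_mulVec_eq_zero_iff.mpr hdet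
  apply hv0
  have hNR : (0 : ℝ) < N := by exact_mod_cast hN
  set S : ℝ := ∑ i, (m i - 2) ^ 2 * c i with hS
  set Tb : ℝ := ∑ i, T i with hTb
  have hS0 : 0 ≤ S := Finset.sum_nonneg fun i _ => mul_nonneg (sq_nonneg _) (hc i).le
  have hT0 : 0 < Tb := Finset.sum_pos (fun i _ => hT i) ⟨⟨0, hn⟩, Finset.mem_univ _⟩
  set X : ℝ := ∑ t, v (Sum.inl t) with hX
  have hy : ∀ i, (N : ℝ) * v (Sum.inr i) = ((N : ℝ) - 1) * (m i - 2) * X := by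
    intro i
    have h := congrFun hv (Sum.inr i)
    simp only [Matrix.mulVec, dotProduct, Fintype.sum_sum_type, hMit, hMii, Pi.zero_apply,
      ite_mul, zero_mul, Finset.sum_ite_eq, Finset.mem_univ, if_true] at h
    rw [← Finset.mul_sum, ← hX] at h
    have h2 : c i * ((N : ℝ) * v (Sum.inr i) - ((N : ℝ) - 1) * (m i - 2) * X) = 0 := by
      linear_combination h
    have := (mul_eq_zero.mp h2).resolve_left (hc i).ne'
    linarith
  have hsum : (N : ℝ) * ∑ i, ((N : ℝ) - 1) * (2 - m i) * c i * v (Sum.inr i)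
      = -(((N : ℝ) - 1) ^ 2 * X) * S := by
    rw [hS, Finset.mul_sum, Finset.mul_sum]
    refine Finset.sum_congr rfl fun i _ => ?_
    linear_combination ((N : ℝ) - 1) * (2 - m i) * c i * hy i
  have hx : ∀ t, (N : ℝ) * (S + Tb) * v (Sum.inl t) = S * X := by
    intro t
    have h := congrFun hv (Sum.inl t)
    simp only [Matrix.mulVec, dotProduct, Fintype.sum_sum_type, hMti, hMtt,
      Pi.zero_apply] at h
    have h1 : ∑ t', (if t = t' then ((N : ℝ) - 1) * S + Tb else ((N : ℝ) - 2) * S)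
        * v (Sum.inl t') = (S + Tb) * v (Sum.inl t) + ((N : ℝ) - 2) * S * X := by
      have h3 : ∀ t', (if t = t' then ((N : ℝ) - 1) * S + Tb else ((N : ℝ) - 2) * S)
        * v (Sum.inl t') = (if t = t' then (S + Tb) * v (Sum.inl t') else 0)
          + ((N : ℝ) - 2) * S * v (Sum.inl t') := by
        intro t'
        split_ifs <;> ring
      simp only [h3, Finset.sum_add_distrib, Finset.sum_ite_eq, Finset.mem_univ, if_true,
        ← Finset.mul_sum, hX]
    rw [h1] at h
    linear_combination (N : ℝ) * h - hsum
  have hX0 : X = 0 := by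
    have h : ∑ t : Fin N, (N : ℝ) * (S + Tb) * v (Sum.inl t) = ∑ t : Fin N, S * X :=
      Finset.sum_congr rfl fun t _ => hx t
    rw [← Finset.mul_sum, ← hX, Finset.sum_const, Finset.card_univ, Fintype.card_fin,
      nsmul_eq_mul] at h
    have h2 : ((N : ℝ) * Tb) * X = 0 := by linear_combination h
    exact (mul_eq_zero.mp h2).resolve_left (mul_pos hNR hT0).ne'
  funext k
  rcases k with t | i
  · have h := hx t
    rw [hX0, mul_zero] at h
    exact (mul_eq_zero.mp h).resolve_left (mul_pos hNR (by linarith)).ne'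
  · have h := hy i
    rw [hX0, mul_zero] at h
    exact (mul_eq_zero.mp h).resolve_left hNR.ne'
end

section
/- Let ℝ² denote the Euclidean plane with Lebesgue measure, and let 2 < m < 4. Let H : ℝ² → ℝ be twice continuously differentiable (ContDiff ℝ 2). Then the improper integral ∫_{B₁(0)} (H(x) − H(0))/‖x‖^m dx converges: there exists D ∈ ℝ such that ∫_{B₁(0) \ B_ε(0)} (H(x) − H(0))/‖x‖^m dx → D as ε → 0⁺. -/
open MeasureTheory Metric


lemma second_diff_bound (H : EuclideanSpace ℝ (Fin 2) → ℝ) (hH : ContDiff ℝ 2 H) :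
    ∃ C : ℝ, 0 ≤ C ∧ ∀ x ∈ ball (0 : EuclideanSpace ℝ (Fin 2)) 1, |H x + H (-x) - 2 * H 0| ≤ C * ‖x‖ ^ 2 := by
  have h1 : ContDiff ℝ 1 (fderiv ℝ H) := hH.fderiv_right (by norm_num)
  have h2 : Continuous (fderiv ℝ (fderiv ℝ H)) := h1.continuous_fderiv (by norm_num)
  obtain ⟨K, hK⟩ := (isCompact_closedBall (0 : EuclideanSpace ℝ (Fin 2)) 1).exists_bound_of_continuousOn
    (f := fderiv ℝ (fderiv ℝ H)) h2.continuousOn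
  have hK0 : 0 ≤ K := (norm_nonneg _).trans (hK 0 (by simp))
  have hd : Differentiable ℝ H := hH.differentiable (by norm_num)
  have hd1 : Differentiable ℝ (fderiv ℝ H) := h1.differentiable (by norm_num)
  have hlip : ∀ x ∈ closedBall (0 : EuclideanSpace ℝ (Fin 2)) 1, ∀ y ∈ closedBall (0 : EuclideanSpace ℝ (Fin 2)) 1,
      ‖fderiv ℝ H y - fderiv ℝ H x‖ ≤ K * ‖y - x‖ := fun x hx y hy =>
    (convex_closedBall (0 : EuclideanSpace ℝ (Fin 2)) 1).norm_image_sub_le_of_norm_fderiv_le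
      (fun z _ => hd1 z) hK hx hy
  refine ⟨2 * K, by positivity, fun x hx => ?_⟩
  have hx1 : ‖x‖ < 1 := by simpa using hx
  have hder : ∀ z : EuclideanSpace ℝ (Fin 2), HasFDerivAt (fun y => H y + H (-y))
      (fderiv ℝ H z - fderiv ℝ H (-z)) z := by
    intro z
    have h := (hd (-z)).hasFDerivAt.comp z (hasFDerivAt_id z).neg
    have := (hd z).hasFDerivAt.add h
    convert! this using 1
    ext v
    simp [sub_eq_add_neg]
  have key := (convex_closedBall (0 : EuclideanSpace ℝ (Fin 2)) ‖x‖).norm_image_sub_le_of_norm_hasFDerivWithin_le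
    (f := fun y => H y + H (-y)) (f' := fun z => fderiv ℝ H z - fderiv ℝ H (-z))
    (C := 2 * K * ‖x‖) (x := 0) (y := x) (fun z _ => (hder z).hasFDerivWithinAt)
    (fun z hz => by
      have hz' : ‖z‖ ≤ ‖x‖ := by simpa using hz
      have := hlip (-z) (by simp; linarith) z (by simp; linarith)
      refine this.trans ?_
      have : ‖z - -z‖ ≤ 2 * ‖x‖ := by
        rw [sub_neg_eq_add]
        linarith [norm_add_le z z]
      nlinarith) (by simp) (by simp)
  simp only [neg_zero, sub_zero, Real.norm_eq_abs] at key
  calc _ = |H x + H (-x) - (H 0 + H 0)| := by ring_nf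
    _ ≤ _ := key
    _ = _ := by ring

/-- for `2 < m < 4` and `H` of class `C²`, the principal-value integral
`∫_{B₁(0)} (H(x) − H(0))/‖x‖^m dx` on the plane converges. -/
theorem pv_integral_converges (m : ℝ) (hm2 : 2 < m) (hm4 : m < 4)
    (H : EuclideanSpace ℝ (Fin 2) → ℝ) (hH : ContDiff ℝ 2 H) :
    ∃ D : ℝ, Filter.Tendsto
      (fun ε : ℝ =>
        ∫ x in ball (0 : EuclideanSpace ℝ (Fin 2)) 1 \ ball (0 : EuclideanSpace ℝ (Fin 2)) ε,
          (H x - H 0) / ‖x‖ ^ m)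
      (nhdsWithin 0 (Set.Ioi 0)) (nhds D) := by
  obtain ⟨C, hC0, hC⟩ := second_diff_bound H hH
  set G : EuclideanSpace ℝ (Fin 2) → ℝ := fun x => (H x + H (-x) - 2 * H 0) / 2 / ‖x‖ ^ m with hG
  have hc := hH.continuous
  have hGm : Measurable G := by
    have : Measurable H := hc.measurable
    fun_prop
  -- dominating function
  have hb : IntegrableOn (fun x : EuclideanSpace ℝ (Fin 2) => C * ‖x‖ ^ (2 - m)) (ball 0 1) := by
    apply Integrable.const_mul
    refine (integrableOn_fun_norm_addHaar (volume : Measure (EuclideanSpace ℝ (Fin 2))) (f := fun r => r ^ (2 - m))).2 ?_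
    have h3 : IntegrableOn (fun r : ℝ => r ^ (3 - m)) (Set.Ioo 0 1) :=
      (intervalIntegral.integrableOn_Ioo_rpow_iff zero_lt_one).2 (by linarith)
    refine h3.congr_fun (fun r hr => ?_) measurableSet_Ioo
    have hr0 : 0 < r := hr.1
    simp only [finrank_euclideanSpace_fin, smul_eq_mul]
    rw [show (3 - m) = 1 + (2 - m) by ring, Real.rpow_add hr0]
    simp
  have hGb : ∀ x ∈ ball (0 : EuclideanSpace ℝ (Fin 2)) 1, ‖G x‖ ≤ C * ‖x‖ ^ (2 - m) := by
    intro x hx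
    rcases eq_or_ne x 0 with rfl | h0
    · have : G 0 = 0 := by simp [hG, two_mul]
      rw [this, norm_zero]; positivity
    · have hx0 : 0 < ‖x‖ := norm_pos_iff.2 h0
      have := hC x hx
      rw [hG, Real.norm_eq_abs, abs_div, abs_div, abs_of_pos (Real.rpow_pos_of_pos hx0 m),
        Real.rpow_sub hx0, ← mul_div_assoc]
      gcongr
      rw [abs_two, Real.rpow_two]
      nlinarith [abs_nonneg (H x + H (-x) - 2 * H 0)]
  have hGi : IntegrableOn G (ball 0 1) :=
    hb.mono' hGm.aestronglyMeasurable
      ((ae_restrict_iff' measurableSet_ball).2 (.of_forall hGb))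
  refine ⟨∫ x in ball 0 1, G x, ?_⟩
  have hlim : Filter.Tendsto (fun ε : ℝ => ∫ x in ball (0 : EuclideanSpace ℝ (Fin 2)) 1 \ ball (0 : EuclideanSpace ℝ (Fin 2)) ε, G x)
      (nhdsWithin 0 (Set.Ioi 0)) (nhds (∫ x in ball 0 1, G x)) := by
    have hms : ∀ ε : ℝ, MeasurableSet (ball (0 : EuclideanSpace ℝ (Fin 2)) 1 \ ball (0 : EuclideanSpace ℝ (Fin 2)) ε) := fun ε =>
      measurableSet_ball.diff measurableSet_ball
    simp_rw [← integral_indicator (hms _), ← integral_indicator (measurableSet_ball (x := (0 : EuclideanSpace ℝ (Fin 2))))]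
    refine tendsto_integral_filter_of_dominated_convergence
      (fun x => ‖(ball (0 : EuclideanSpace ℝ (Fin 2)) 1).indicator G x‖) ?_ ?_ ?_ ?_
    · exact .of_forall fun ε => (hGm.indicator (hms ε)).aestronglyMeasurable
    · refine .of_forall fun ε => .of_forall fun x => ?_
      simp only [Set.indicator]
      by_cases h : x ∈ ball (0 : EuclideanSpace ℝ (Fin 2)) 1 \ ball (0 : EuclideanSpace ℝ (Fin 2)) ε
      · simp [h, h.1]
      · rw [if_neg h]; simp
    · exact ((integrable_indicator_iff measurableSet_ball).2 hGi).norm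
    · have hne : ∀ᵐ x : EuclideanSpace ℝ (Fin 2), x ≠ 0 := by simp [ae_iff]
      filter_upwards [hne] with x hx
      have hx0 : 0 < ‖x‖ := norm_pos_iff.2 hx
      refine tendsto_const_nhds.congr' ?_
      have : ∀ᶠ ε : ℝ in nhdsWithin 0 (Set.Ioi 0), ε < ‖x‖ :=
        nhdsWithin_le_nhds (Iio_mem_nhds hx0)
      filter_upwards [this] with ε hε
      have : x ∉ ball (0 : EuclideanSpace ℝ (Fin 2)) ε := by simp; linarith
      simp [Set.indicator, this]
  refine hlim.congr' ?_
  filter_upwards [self_mem_nhdsWithin] with ε hε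
  have hε : 0 < ε := hε
  set A := ball (0 : EuclideanSpace ℝ (Fin 2)) 1 \ ball (0 : EuclideanSpace ℝ (Fin 2)) ε with hA
  have hAm : MeasurableSet A := measurableSet_ball.diff measurableSet_ball
  set f : EuclideanSpace ℝ (Fin 2) → ℝ := fun x => (H x - H 0) / ‖x‖ ^ m with hf
  have hfi : IntegrableOn f A := by
    have hcomp : IsCompact (closedBall (0 : EuclideanSpace ℝ (Fin 2)) 1 \ ball (0 : EuclideanSpace ℝ (Fin 2)) ε) :=
      (isCompact_closedBall _ _).diff isOpen_ball
    refine (ContinuousOn.integrableOn_compact hcomp ?_).mono_set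
      (Set.sdiff_subset_sdiff_left ball_subset_closedBall)
    intro x hx
    have hx0 : 0 < ‖x‖ := by
      have : ε ≤ ‖x‖ := by simpa using hx.2
      linarith
    refine ContinuousAt.continuousWithinAt ?_
    refine ContinuousAt.div (by fun_prop) ?_ (Real.rpow_pos_of_pos hx0 m).ne'
    exact continuousAt_id.norm.rpow_const (Or.inl hx0.ne')
  have hAneg : (fun x : EuclideanSpace ℝ (Fin 2) => -x) ⁻¹' A = A := by ext x; simp [hA]
  have hmp := Measure.measurePreserving_neg (volume : Measure (EuclideanSpace ℝ (Fin 2)))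
  have hme : MeasurableEmbedding (fun x : EuclideanSpace ℝ (Fin 2) => -x) := (MeasurableEquiv.neg (EuclideanSpace ℝ (Fin 2))).measurableEmbedding
  have hfi' : IntegrableOn (fun x => f (-x)) A := by
    have := (hmp.integrableOn_comp_preimage hme (f := f) (s := A)).2 hfi
    rwa [hAneg] at this
  have hint : ∫ x in A, f (-x) = ∫ x in A, f x := by
    have := hmp.setIntegral_preimage_emb hme f A
    rwa [hAneg] at this
  have hGf : G = fun x => (f x + f (-x)) / 2 := by
    funext x; simp only [hG, hf, norm_neg]; ring
  rw [hGf, integral_div, integral_add hfi hfi', hint]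
  ring
end

section
/- Let ℝ² denote the Euclidean plane with Lebesgue measure. Let H : ℝ² → ℝ be three times continuously differentiable (ContDiff ℝ 3), and assume that the derivative of H at 0 vanishes (fderiv ℝ H 0 = 0) and that the Laplacian of H at 0 vanishes, i.e. the trace of the second derivative of H at 0 is zero: Σ_{k=1,2} (iteratedFDeriv ℝ 2 H 0)(e_k, e_k) = 0, where e₁, e₂ is the standard orthonormal basis. Then the improper integral ∫_{B₁(0)} (H(x) − H(0))/‖x‖⁴ dx converges: there exists D ∈ ℝ such that ∫_{B₁(0) \ B_ε(0)} (H(x) − H(0))/‖x‖⁴ dx → D as ε → 0⁺. -/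
open MeasureTheory Metric

/-- Rotation by a right angle in the plane. -/
noncomputable def rotQuarter : EuclideanSpace ℝ (Fin 2) ≃ₗᵢ[ℝ] EuclideanSpace ℝ (Fin 2) where
  toFun x := !₂[-x 1, x 0]
  invFun x := !₂[x 1, -x 0]
  map_add' x y := by
    ext i; fin_cases i <;> simp <;> ring
  map_smul' c x := by
    ext i; fin_cases i <;> simp
  left_inv x := by
    ext i; fin_cases i <;> simp
  right_inv x := by
    ext i; fin_cases i <;> simp
  norm_map' x := by
    simp [EuclideanSpace.norm_eq, Fin.sum_univ_two, add_comm]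

theorem rotQuarter_apply (x : EuclideanSpace ℝ (Fin 2)) :
    rotQuarter x = !₂[-x 1, x 0] := rfl

/-- The trace-free quadratic form is killed by averaging over a quarter turn. -/
theorem quad_rotQuarter
    (B : EuclideanSpace ℝ (Fin 2) →L[ℝ] EuclideanSpace ℝ (Fin 2) →L[ℝ] ℝ)
    (hB : ∑ k : Fin 2, B (EuclideanSpace.single k (1 : ℝ)) (EuclideanSpace.single k (1 : ℝ)) = 0)
    (x : EuclideanSpace ℝ (Fin 2)) :
    B x x + B (rotQuarter x) (rotQuarter x) = 0 := by
  have h1 : x = x 0 • EuclideanSpace.single 0 (1 : ℝ) + x 1 • EuclideanSpace.single 1 (1 : ℝ) := by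
    ext i; fin_cases i <;> simp
  have h2 : rotQuarter x = (-x 1) • EuclideanSpace.single 0 (1 : ℝ)
      + x 0 • EuclideanSpace.single 1 (1 : ℝ) := by
    rw [rotQuarter_apply]
    ext i; fin_cases i <;> simp
  rw [Fin.sum_univ_two] at hB
  rw [h2]
  generalize x 0 = a at *
  generalize x 1 = b at *
  rw [h1]
  simp only [map_add, map_smul, add_apply, ContinuousLinearMap.smul_apply, smul_eq_mul]
  linear_combination (a ^ 2 + b ^ 2) * hB

/-- Third order Taylor bound. -/
theorem taylor_bound (H : EuclideanSpace ℝ (Fin 2) → ℝ) (hH : ContDiff ℝ 3 H)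
    (hgrad : fderiv ℝ H 0 = 0) :
    ∃ C : ℝ, ∀ x ∈ ball (0 : EuclideanSpace ℝ (Fin 2)) 1,
      |H x - H 0 - (1 / 2) * fderiv ℝ (fderiv ℝ H) 0 x x| ≤ C * ‖x‖ ^ 3 := by
  have hc : Continuous (iteratedFDeriv ℝ 3 H) := hH.continuous_iteratedFDeriv (by norm_num)
  obtain ⟨C, hC⟩ := (isCompact_closedBall (0 : EuclideanSpace ℝ (Fin 2)) 1).exists_bound_of_continuousOn
    hc.continuousOn
  refine ⟨(1 / 2) * C, fun x hx => ?_⟩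
  have hx' : ‖x‖ < 1 := by simpa using hx
  have hT := map_add_eq_sum_add_integral_iteratedFDeriv (f := H) (x := 0) (y := x) (n := 2)
    (fun t _ => by
      have : ContDiff ℝ ((2 : ℕ) + 1) H := by norm_num; exact hH
      exact this.contDiffAt)
  have hI : ‖∫ t in (0 : ℝ)..1, (1 - t) ^ 2 • iteratedFDeriv ℝ (2 + 1) H (0 + t • x) (fun _ ↦ x)‖
      ≤ (C * ‖x‖ ^ 3) * |(1 : ℝ) - 0| := by
    apply intervalIntegral.norm_integral_le_of_norm_le_const
    intro t ht
    rw [Set.uIoc_of_le zero_le_one] at ht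
    have hm : t • x ∈ closedBall (0 : EuclideanSpace ℝ (Fin 2)) 1 := by
      rw [mem_closedBall_zero_iff, norm_smul, Real.norm_eq_abs, abs_of_pos ht.1]
      nlinarith [norm_nonneg x, ht.1, ht.2]
    have h1 := (iteratedFDeriv ℝ 3 H (t • x)).le_opNorm (fun _ => x)
    have h2 := hC _ hm
    simp only [Finset.prod_const, Finset.card_univ, Fintype.card_fin] at h1
    have h3 : ‖iteratedFDeriv ℝ 3 H (t • x) (fun _ => x)‖ ≤ C * ‖x‖ ^ 3 :=
      h1.trans (mul_le_mul_of_nonneg_right h2 (by positivity))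
    rw [zero_add, norm_smul]
    have h4 : ‖(1 - t) ^ 2‖ ≤ 1 := by
      rw [Real.norm_eq_abs, abs_of_nonneg (sq_nonneg _)]
      nlinarith [ht.1, ht.2]
    calc _ ≤ 1 * ‖iteratedFDeriv ℝ 3 H (t • x) (fun _ => x)‖ :=
          mul_le_mul_of_nonneg_right h4 (norm_nonneg _)
      _ ≤ _ := by rw [one_mul]; exact h3
  simp only [Finset.sum_range_succ, Finset.sum_range_zero, iteratedFDeriv_zero_apply,
    iteratedFDeriv_one_apply, iteratedFDeriv_two_apply, hgrad, zero_apply] at hT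
  rw [zero_add x] at hT
  have hE : H x - H 0 - (1 / 2) * fderiv ℝ (fderiv ℝ H) 0 x x = (1 / 2) *
      ∫ t in (0 : ℝ)..1, (1 - t) ^ 2 • iteratedFDeriv ℝ (2 + 1) H (0 + t • x) (fun _ ↦ x) := by
    rw [hT]
    simp [Nat.factorial]
    ring
  rw [hE, abs_mul, abs_of_pos (by norm_num : (0 : ℝ) < 1 / 2), mul_assoc]
  rw [Real.norm_eq_abs] at hI
  simp only [sub_zero, abs_one, mul_one] at hI
  gcongr

/-- critical case `m = 4`.  If `H` is `C³`, its derivative at `0` vanishes and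
its Laplacian at `0` vanishes, then the principal-value integral
`∫_{B₁(0)} (H(x) − H(0))/‖x‖⁴ dx` on the plane converges. -/
theorem pv_integral_converges_critical
    (H : EuclideanSpace ℝ (Fin 2) → ℝ) (hH : ContDiff ℝ 3 H)
    (hgrad : fderiv ℝ H 0 = 0)
    (hlap : ∑ k : Fin 2,
      iteratedFDeriv ℝ 2 H 0 (fun _ => EuclideanSpace.single k (1 : ℝ)) = 0) :
    ∃ D : ℝ, Filter.Tendsto
      (fun ε : ℝ =>
        ∫ x in ball (0 : EuclideanSpace ℝ (Fin 2)) 1 \ ball (0 : EuclideanSpace ℝ (Fin 2)) ε,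
          (H x - H 0) / ‖x‖ ^ 4)
      (nhdsWithin 0 (Set.Ioi 0)) (nhds D) := by
  obtain ⟨C, hC⟩ := taylor_bound H hH hgrad
  simp only [iteratedFDeriv_two_apply] at hlap
  set B := fderiv ℝ (fderiv ℝ H) 0 with hBdef
  have hQ := quad_rotQuarter B hlap
  have hHc : Continuous H := hH.continuous
  have hBc : Continuous (fun x => B x x) := by fun_prop
  set G : EuclideanSpace ℝ (Fin 2) → ℝ :=
    fun x => (H x - H 0 - (1 / 2) * B x x) / ‖x‖ ^ 4 with hG
  have hGint : IntegrableOn G (ball 0 1) := by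
    refine integrableOn_ball_of_norm_le_rpow (C := C) (α := 1) (by simp) (by simp) ?_ ?_
    · refine (ae_restrict_mem measurableSet_ball).mono fun x hx => ?_
      have h := hC x hx
      rw [hG, Real.norm_eq_abs, abs_div, abs_of_nonneg (by positivity : 0 ≤ ‖x‖ ^ 4),
        Real.rpow_neg_one]
      rcases eq_or_ne x 0 with rfl | h0
      · simp
      · have : 0 < ‖x‖ := norm_pos_iff.mpr h0
        rw [div_le_iff₀ (by positivity)]
        refine h.trans (le_of_eq ?_)
        field_simp
    · refine Measurable.aestronglyMeasurable ?_
      refine Measurable.div ?_ (by fun_prop)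
      exact Continuous.measurable (by fun_prop)
  have hcov : AECover (volume.restrict (ball (0 : EuclideanSpace ℝ (Fin 2)) 1))
      (nhdsWithin (0 : ℝ) (Set.Ioi 0))
      (fun ε => (ball (0 : EuclideanSpace ℝ (Fin 2)) ε)ᶜ) := by
    refine ⟨?_, fun ε => measurableSet_ball.compl⟩
    refine ae_restrict_of_ae ?_
    have h0 : ∀ᵐ x : EuclideanSpace ℝ (Fin 2), x ≠ 0 := by
      simp [ae_iff]
    filter_upwards [h0] with x hx
    have : Set.Iio ‖x‖ ∈ nhdsWithin (0 : ℝ) (Set.Ioi 0) :=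
      nhdsWithin_le_nhds (Iio_mem_nhds (norm_pos_iff.mpr hx))
    filter_upwards [this] with ε hε
    simpa using le_of_lt hε
  refine ⟨∫ x in ball 0 1, G x, ?_⟩
  refine (hcov.integral_tendsto_of_countably_generated hGint).congr' ?_
  filter_upwards [self_mem_nhdsWithin] with ε hε
  have hε : 0 < ε := hε
  rw [Measure.restrict_restrict measurableSet_ball.compl]
  have hset : (ball (0 : EuclideanSpace ℝ (Fin 2)) ε)ᶜ ∩ ball 0 1 = ball 0 1 \ ball 0 ε := by
    rw [Set.inter_comm]; rfl
  rw [hset]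
  set A := ball (0 : EuclideanSpace ℝ (Fin 2)) 1 \ ball 0 ε with hA
  have hAm : MeasurableSet A := measurableSet_ball.diff measurableSet_ball
  have hint : ∀ f : EuclideanSpace ℝ (Fin 2) → ℝ, Continuous f →
      IntegrableOn (fun x => f x / ‖x‖ ^ 4) A := by
    intro f hf
    have hK : IsCompact (closedBall (0 : EuclideanSpace ℝ (Fin 2)) 1 \ ball 0 ε) :=
      (isCompact_closedBall _ _).diff isOpen_ball
    refine (ContinuousOn.integrableOn_compact hK ?_).mono_set
      (Set.diff_subset_diff_left ball_subset_closedBall)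
    refine hf.continuousOn.div (by fun_prop) ?_
    intro x hx
    have : ε ≤ ‖x‖ := by simpa using hx.2
    have : 0 < ‖x‖ := hε.trans_le this
    positivity
  have hzero : ∫ x in A, B x x / ‖x‖ ^ 4 = 0 := by
    have hmp := (rotQuarter.measurePreserving).setIntegral_preimage_emb
      rotQuarter.toHomeomorph.measurableEmbedding (fun x => B x x / ‖x‖ ^ 4) A
    have hpre : rotQuarter ⁻¹' A = A := by
      ext x; simp [hA]
    rw [hpre] at hmp
    have : ∀ x, B (rotQuarter x) (rotQuarter x) / ‖rotQuarter x‖ ^ 4 = -(B x x / ‖x‖ ^ 4) := by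
      intro x
      rw [LinearIsometryEquiv.norm_map, ← neg_div]
      congr 1
      linarith [hQ x]
    simp only [this] at hmp
    rw [integral_neg] at hmp
    linarith
  have hsplit : ∀ x, G x = (H x - H 0) / ‖x‖ ^ 4 - (1 / 2) * (B x x / ‖x‖ ^ 4) := by
    intro x; simp only [hG]; ring
  simp only [hsplit]
  rw [integral_sub (hint _ (by fun_prop)) ((hint _ hBc).const_mul _), integral_const_mul, hzero]
  simp
end

section
/- Let ℝ² denote the Euclidean plane with Lebesgue measure. Let m > 2 and τ ∈ (0, m−2). Then there exists a constant C > 0 such that for every y ∈ ℝ² with ‖y‖ ≥ 2, ∫_{ℝ²} ( log‖y‖ + |log‖η‖| + |log‖y−η‖| ) · (1 + ‖η‖)^{τ−m} dη ≤ C · log‖y‖. -/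
open MeasureTheory

/-- The singular comparison function `‖x‖⁻¹` on the unit ball is integrable on the plane. -/
lemma green_aux_sing : Integrable (fun x : EuclideanSpace ℝ (Fin 2) =>
    Set.indicator (Set.Iio (1:ℝ)) (fun t : ℝ => t⁻¹) ‖x‖) := by
  rw [integrable_fun_norm_addHaar volume (f := Set.indicator (Set.Iio (1:ℝ)) (fun t : ℝ => t⁻¹))]
  have h1 : IntegrableOn (fun _ : ℝ => (1:ℝ)) (Set.Ioo 0 1) := by simp
  have h2 : IntegrableOn (Set.indicator (Set.Ioo (0:ℝ) 1) (fun _ : ℝ => (1:ℝ))) (Set.Ioi 0) :=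
    (h1.integrable_indicator measurableSet_Ioo).integrableOn
  refine h2.congr_fun ?_ measurableSet_Ioi
  intro t ht
  have ht' : (0:ℝ) < t := ht
  by_cases h : t < 1
  · simp [Set.indicator, h, ht', ht'.ne']
  · simp [Set.indicator, h]

lemma green_aux_log (t : ℝ) (ht : 0 ≤ t) :
    |Real.log t| ≤ Real.log (1 + t) + Set.indicator (Set.Iio (1:ℝ)) (fun t : ℝ => t⁻¹) t := by
  rcases ht.eq_or_lt with rfl | ht
  · simp
  have h0 : 0 ≤ Real.log (1 + t) := Real.log_nonneg (by linarith)
  by_cases h : t < 1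
  · have h1 : Real.log t ≤ 0 := Real.log_nonpos ht.le h.le
    have h2 := Real.log_le_sub_one_of_pos (inv_pos.mpr ht)
    rw [Real.log_inv] at h2
    rw [abs_of_nonpos h1]
    simp only [Set.indicator, Set.mem_Iio, h, if_true]
    linarith
  · have h1 : 0 ≤ Real.log t := Real.log_nonneg (not_lt.mp h)
    have h2 : Real.log t ≤ Real.log (1 + t) := Real.log_le_log ht (by linarith)
    rw [abs_of_nonneg h1]
    simpa [Set.indicator, h] using h2

lemma green_aux_div (a b c : ℝ) (ha : 0 ≤ a) (hb : 0 < b) (h : b ≤ c) : a ≤ a / b * c := by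
  rw [div_mul_eq_mul_div, le_div_iff₀ hb]
  exact mul_le_mul_of_nonneg_left h ha

set_option maxHeartbeats 1000000 in
/-- the Green's-function comparison integral
`∫_{ℝ²} (log‖y‖ + |log‖η‖| + |log‖y−η‖|)(1+‖η‖)^{τ−m} dη` is finite and bounded by
`C log‖y‖` for `‖y‖ ≥ 2`, when `m > 2` and `0 < τ < m − 2`. -/
theorem green_comparison_bound (m τ : ℝ) (hm : 2 < m) (hτ : 0 < τ) (hτm : τ < m - 2) :
    ∃ C > (0:ℝ), ∀ y : EuclideanSpace ℝ (Fin 2), 2 ≤ ‖y‖ →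
      Integrable (fun η : EuclideanSpace ℝ (Fin 2) =>
        (Real.log ‖y‖ + |Real.log ‖η‖| + |Real.log ‖y - η‖|) * (1 + ‖η‖) ^ (τ - m)) ∧
      (∫ η : EuclideanSpace ℝ (Fin 2),
        (Real.log ‖y‖ + |Real.log ‖η‖| + |Real.log ‖y - η‖|) * (1 + ‖η‖) ^ (τ - m))
        ≤ C * Real.log ‖y‖ := by
  set g : ℝ → ℝ := Set.indicator (Set.Iio (1:ℝ)) (fun t : ℝ => t⁻¹) with hg
  have hgi : Integrable (fun x : EuclideanSpace ℝ (Fin 2) => g ‖x‖) := green_aux_sing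
  have hg0 : ∀ t, 0 ≤ t → 0 ≤ g t := by
    intro t ht
    by_cases h : t < 1 <;> simp [hg, Set.indicator, h, ht]
  obtain ⟨δ, hδ, hδm⟩ : ∃ δ > 0, δ < m - 2 - τ := ⟨(m - 2 - τ) / 2, by linarith, by linarith⟩
  have hk : Integrable (fun x : EuclideanSpace ℝ (Fin 2) => (1 + ‖x‖) ^ (τ - m)) := by
    have := integrable_one_add_norm (E := EuclideanSpace ℝ (Fin 2)) (μ := volume) (r := m - τ)
      (by simp; linarith)
    simpa using this
  have hk1 : Integrable (fun x : EuclideanSpace ℝ (Fin 2) => (1 + ‖x‖) ^ (τ - m + δ)) := by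
    have := integrable_one_add_norm (E := EuclideanSpace ℝ (Fin 2)) (μ := volume)
      (r := m - τ - δ) (by simp; linarith)
    convert this using 3
    ring
  set K := ∫ x : EuclideanSpace ℝ (Fin 2), (1 + ‖x‖) ^ (τ - m) with hK
  set K1 := ∫ x : EuclideanSpace ℝ (Fin 2), (1 + ‖x‖) ^ (τ - m + δ) with hK1
  set G := ∫ x : EuclideanSpace ℝ (Fin 2), g ‖x‖ with hG
  have hKn : 0 ≤ K := integral_nonneg fun x => by positivity
  have hK1n : 0 ≤ K1 := integral_nonneg fun x => by positivity
  have hGn : 0 ≤ G := integral_nonneg fun x => hg0 _ (norm_nonneg _)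
  have hl2 : 0 < Real.log 2 := Real.log_pos (by norm_num)
  refine ⟨3 * K + (2 / δ * K1 + 2 * G) / Real.log 2 + 1, by positivity, ?_⟩
  intro y hy
  have hly : Real.log 2 ≤ Real.log ‖y‖ := Real.log_le_log (by norm_num) hy
  have hly1 : Real.log (1 + ‖y‖) ≤ 2 * Real.log ‖y‖ := by
    have : Real.log (1 + ‖y‖) ≤ Real.log (‖y‖ ^ 2) :=
      Real.log_le_log (by linarith) (by nlinarith)
    simpa using this
  have hgy : Integrable (fun x : EuclideanSpace ℝ (Fin 2) => g ‖y - x‖) :=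
    hgi.comp_sub_left y
  have hGy : ∫ x : EuclideanSpace ℝ (Fin 2), g ‖y - x‖ = G :=
    integral_sub_left_eq_self (fun x : EuclideanSpace ℝ (Fin 2) => g ‖x‖) volume y
  have hA : Integrable (fun x : EuclideanSpace ℝ (Fin 2) =>
      3 * Real.log ‖y‖ * (1 + ‖x‖) ^ (τ - m) + 2 / δ * (1 + ‖x‖) ^ (τ - m + δ)) :=
    (hk.const_mul _).add (hk1.const_mul _)
  have hB : Integrable (fun x : EuclideanSpace ℝ (Fin 2) => g ‖x‖ + g ‖y - x‖) := hgi.add hgy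
  have hbound : ∀ x : EuclideanSpace ℝ (Fin 2),
      (Real.log ‖y‖ + |Real.log ‖x‖| + |Real.log ‖y - x‖|) * (1 + ‖x‖) ^ (τ - m) ≤
      (3 * Real.log ‖y‖ * (1 + ‖x‖) ^ (τ - m) + 2 / δ * (1 + ‖x‖) ^ (τ - m + δ))
        + (g ‖x‖ + g ‖y - x‖) := by
    intro x
    have hx := norm_nonneg x
    have e1 := green_aux_log ‖x‖ hx
    have e2 := green_aux_log ‖y - x‖ (norm_nonneg _)
    rw [← hg] at e1 e2
    have e3 : Real.log (1 + ‖y - x‖) ≤ Real.log (1 + ‖y‖) + Real.log (1 + ‖x‖) := by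
      rw [← Real.log_mul (by positivity) (by positivity)]
      refine Real.log_le_log (by positivity) ?_
      have := norm_sub_le y x
      nlinarith [mul_nonneg (norm_nonneg y) hx]
    have e4 : Real.log (1 + ‖x‖) ≤ (1 + ‖x‖) ^ δ / δ :=
      Real.log_le_rpow_div (by positivity) hδ
    have hkp : 0 ≤ (1 + ‖x‖) ^ (τ - m) := by positivity
    have hkle : (1 + ‖x‖) ^ (τ - m) ≤ 1 :=
      Real.rpow_le_one_of_one_le_of_nonpos (by linarith) (by linarith)
    have e5 : Real.log ‖y‖ + |Real.log ‖x‖| + |Real.log ‖y - x‖| ≤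
        3 * Real.log ‖y‖ + 2 / δ * (1 + ‖x‖) ^ δ + (g ‖x‖ + g ‖y - x‖) := by
      have : 2 / δ * (1 + ‖x‖) ^ δ = 2 * ((1 + ‖x‖) ^ δ / δ) := by ring
      rw [this]
      linarith
    have e6 : (g ‖x‖ + g ‖y - x‖) * (1 + ‖x‖) ^ (τ - m) ≤ g ‖x‖ + g ‖y - x‖ :=
      mul_le_of_le_one_right (add_nonneg (hg0 _ hx) (hg0 _ (norm_nonneg _))) hkle
    have e7 := mul_le_mul_of_nonneg_right e5 hkp
    rw [Real.rpow_add (by positivity)]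
    nlinarith
  have hint : Integrable (fun η : EuclideanSpace ℝ (Fin 2) =>
        (Real.log ‖y‖ + |Real.log ‖η‖| + |Real.log ‖y - η‖|) * (1 + ‖η‖) ^ (τ - m)) := by
    refine (hA.add hB).mono' ?_ (Filter.Eventually.of_forall fun x => ?_)
    · refine Measurable.aestronglyMeasurable ?_
      have h1 : Measurable fun η : EuclideanSpace ℝ (Fin 2) => |Real.log ‖η‖| :=
        (Real.measurable_log.comp measurable_norm).abs
      have h2 : Measurable fun η : EuclideanSpace ℝ (Fin 2) => |Real.log ‖y - η‖| :=
        (Real.measurable_log.comp (measurable_const.sub measurable_id).norm).abs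
      exact ((measurable_const.add h1).add h2).mul
        ((measurable_const.add measurable_norm).pow_const _)
    · rw [Real.norm_of_nonneg]
      · exact hbound x
      · have : 0 ≤ Real.log ‖y‖ := hl2.le.trans hly
        positivity
  refine ⟨hint, ?_⟩
  have hle := integral_mono hint (hA.add hB) hbound
  have hval : ∫ x : EuclideanSpace ℝ (Fin 2),
      ((3 * Real.log ‖y‖ * (1 + ‖x‖) ^ (τ - m) + 2 / δ * (1 + ‖x‖) ^ (τ - m + δ))
        + (g ‖x‖ + g ‖y - x‖)) = 3 * Real.log ‖y‖ * K + 2 / δ * K1 + (G + G) := by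
    rw [integral_add hA hB, integral_add (hk.const_mul _) (hk1.const_mul _),
      integral_add hgi hgy, integral_const_mul, integral_const_mul, hGy]
  have hle2 := hle.trans_eq hval
  refine hle2.trans ?_
  have h3 : 2 / δ * K1 + 2 * G ≤ (2 / δ * K1 + 2 * G) / Real.log 2 * Real.log ‖y‖ := by
    have h5 : 0 ≤ 2 / δ * K1 + 2 * G :=
      add_nonneg (mul_nonneg (div_nonneg zero_le_two hδ.le) hK1n) (mul_nonneg zero_le_two hGn)
    exact green_aux_div _ _ _ h5 hl2 hly
  have h4 : 0 ≤ Real.log ‖y‖ := hl2.le.trans hly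
  rw [add_mul, add_mul]
  linarith
end
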